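/- arXiv:2004.06597 — 2 statements merged into one kernel-verified Lean document; each statement's English description precedes it below -/
import Mathlib

section
/- Let I ⊆ R be a monomial ideal. If I is normally torsion-free, then I^[m] is normally torsion-free for all integers m ≥ 2. -/
/-- The `m`-th square power `f^[m] = f(X_1^m, …, X_n^m)` of a polynomial `f`. -/
noncomputable def sqPoly {n : ℕ} {K : Type*} [Field K] (m : ℕ)
    (f : MvPolynomial (Fin n) K) : MvPolynomial (Fin n) K :=
  MvPolynomial.aeval (fun i => (MvPolynomial.X i : MvPolynomial (Fin n) K) ^ m) f

/-- The `m`-th square power `I^[m] = ⟨f^[m] : f ∈ I⟩` of an ideal `I`. -/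
noncomputable def sqPow {n : ℕ} {K : Type*} [Field K] (m : ℕ)
    (I : Ideal (MvPolynomial (Fin n) K)) : Ideal (MvPolynomial (Fin n) K) :=
  I.map (MvPolynomial.aeval (fun i => (MvPolynomial.X i : MvPolynomial (Fin n) K) ^ m))
/-- A monomial ideal: an ideal generated by a set of monomials `X^a`. -/
def IsMonomialIdeal {n : ℕ} {K : Type*} [Field K] (I : Ideal (MvPolynomial (Fin n) K)) : Prop :=
  ∃ A : Set (Fin n →₀ ℕ), I = Ideal.span ((fun a => (MvPolynomial.monomial a (1 : K))) '' A)
/-- An ideal `I` is normally torsion-free if `Ass(R/I^s) ⊆ Ass(R/I)` for all `s ≥ 1`. -/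
def NormallyTorsionFree {R : Type*} [CommRing R] (I : Ideal R) : Prop :=
  ∀ s : ℕ, 1 ≤ s →
    associatedPrimes R (R ⧸ I ^ s) ⊆ associatedPrimes R (R ⧸ I)


open MvPolynomial

section MonomialIdeals

variable {n : ℕ} {K : Type*} [Field K]

theorem IsMonomialIdeal.mul {I J : Ideal (MvPolynomial (Fin n) K)}
    (hI : IsMonomialIdeal I) (hJ : IsMonomialIdeal J) : IsMonomialIdeal (I * J) := by
  obtain ⟨A, rfl⟩ := hI
  obtain ⟨B, rfl⟩ := hJ
  refine ⟨Set.image2 (· + ·) A B, ?_⟩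
  rw [Ideal.span_mul_span', ← Set.image2_mul, Set.image2_image_left, Set.image2_image_right,
    Set.image_image2]
  simp [monomial_mul]

theorem IsMonomialIdeal.pow {I : Ideal (MvPolynomial (Fin n) K)}
    (hI : IsMonomialIdeal I) (s : ℕ) : IsMonomialIdeal (I ^ s) := by
  induction s with
  | zero => exact ⟨{0}, by simp [Ideal.one_eq_top]⟩
  | succ s ih => exact pow_succ I s ▸ ih.mul hI

theorem monomial_mem_of_le {I : Ideal (MvPolynomial (Fin n) K)} {a b : Fin n →₀ ℕ}
    (hab : a ≤ b) (ha : monomial a (1 : K) ∈ I) (c : K) : monomial b c ∈ I := by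
  obtain ⟨d, rfl⟩ := exists_add_of_le hab
  have := I.mul_mem_right (monomial d c) ha
  rwa [monomial_mul, one_mul] at this

theorem mem_of_forall_support {I : Ideal (MvPolynomial (Fin n) K)}
    {f : MvPolynomial (Fin n) K} (h : ∀ a ∈ f.support, monomial a (1 : K) ∈ I) : f ∈ I := by
  rw [f.as_sum]
  exact I.sum_mem fun a ha => monomial_mem_of_le le_rfl (h a ha) _

theorem IsMonomialIdeal.mem_iff {I : Ideal (MvPolynomial (Fin n) K)} (hI : IsMonomialIdeal I)
    {f : MvPolynomial (Fin n) K} : f ∈ I ↔ ∀ a ∈ f.support, monomial a (1 : K) ∈ I := by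
  refine ⟨fun hf a ha => ?_, fun h => mem_of_forall_support h⟩
  obtain ⟨A, rfl⟩ := hI
  obtain ⟨b, hb, hba⟩ := mem_ideal_span_monomial_image.1 hf a ha
  exact monomial_mem_of_le hba 
    (Ideal.subset_span (Set.mem_image_of_mem (fun a => monomial a (1 : K)) hb)) _

theorem support_mul_monomial (g : MvPolynomial (Fin n) K) (a : Fin n →₀ ℕ) :
    (g * monomial a 1).support = g.support.map (addRightEmbedding a) :=
  AddMonoidAlgebra.support_coeff_mul_single _ _ (by simp) _

theorem mul_monomial_mem_iff {I : Ideal (MvPolynomial (Fin n) K)} (hI : IsMonomialIdeal I)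
    (g : MvPolynomial (Fin n) K) (a : Fin n →₀ ℕ) :
    g * monomial a 1 ∈ I ↔ ∀ d ∈ g.support, monomial (d + a) (1 : K) ∈ I := by
  rw [hI.mem_iff]
  simp [support_mul_monomial]

theorem sqPow_span_monomial (m : ℕ) (A : Set (Fin n →₀ ℕ)) :
    sqPow m (Ideal.span ((fun a => monomial a (1 : K)) '' A)) =
      Ideal.span ((fun a => monomial a (1 : K)) '' ((m • ·) '' A)) := by
  rw [sqPow, Ideal.map_span, Set.image_image, Set.image_image]
  congr 2
  ext1 a
  rw [aeval_monomial]
  simp [monomial_eq, Finsupp.prod_fintype, ← pow_mul]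

theorem IsMonomialIdeal.sqPow {I : Ideal (MvPolynomial (Fin n) K)} (hI : IsMonomialIdeal I)
    (m : ℕ) : IsMonomialIdeal (sqPow m I) := by
  obtain ⟨A, rfl⟩ := hI
  exact ⟨_, sqPow_span_monomial m A⟩

theorem monomial_mem_sqPow_iff {I : Ideal (MvPolynomial (Fin n) K)} (hI : IsMonomialIdeal I)
    {m : ℕ} (hm : 0 < m) (e : Fin n →₀ ℕ) :
    monomial e (1 : K) ∈ sqPow m I ↔
      monomial (e.mapRange (· / m) (Nat.zero_div m)) (1 : K) ∈ I := by
  obtain ⟨A, rfl⟩ := hI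
  rw [sqPow_span_monomial, mem_ideal_span_monomial_image, mem_ideal_span_monomial_image]
  simp [Finsupp.le_def, Nat.le_div_iff_mul_le hm, mul_comm]

theorem support_sub_monomial_coeff (f : MvPolynomial (Fin n) K) (b : Fin n →₀ ℕ) :
    (f - monomial b (f.coeff b)).support = f.support.erase b := by
  ext a
  by_cases h : a = b
  · simp [h]
  · simp [h, coeff_monomial, Ne.symm h]

theorem monomial_degree_mem_of_eq_colon {J P : Ideal (MvPolynomial (Fin n) K)}
    (hJ : IsMonomialIdeal J) [hP : P.IsPrime] {f : MvPolynomial (Fin n) K}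
    (hf : ∀ g, g ∈ P ↔ g * f ∈ J) {g : MvPolynomial (Fin n) K} (hg : g ∈ P) (hg0 : g ≠ 0) :
    monomial (MonomialOrder.lex.degree g) (1 : K) ∈ P := by
  induction hN : f.support.card using Nat.strong_induction_on generalizing f with
  | _ N ih =>
    subst hN
    by_contra hlead
    have hf0 : f ≠ 0 := by
      rintro rfl
      exact hP.ne_top ((Ideal.eq_top_iff_one P).2 ((hf 1).2 (by simp)))
    set h : MvPolynomial (Fin n) K := monomial (MonomialOrder.lex.degree g) 1 with hh
    set b := MonomialOrder.lex.degree f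
    have hb : b ∈ f.support := MonomialOrder.lex.degree_mem_support hf0
    have hgf : monomial (MonomialOrder.lex.degree g + b) (1 : K) ∈ J := by
      rw [← MonomialOrder.degree_mul hg0 hf0]
      exact hJ.mem_iff.1 ((hf g).1 hg) _
        (MonomialOrder.lex.degree_mem_support (mul_ne_zero hg0 hf0))
    set f' := f - monomial b (f.coeff b)
    have hcard : (h * f').support.card < f.support.card := by
      rw [mul_comm, hh, support_mul_monomial, Finset.card_map, support_sub_monomial_coeff]
      exact Finset.card_erase_lt_of_mem hb
    refine hlead (ih _ hcard (fun k => ?_) rfl)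
    have hterm : k * (h * monomial b (f.coeff b)) ∈ J := by
      rw [hh, monomial_mul]
      exact J.mul_mem_left _ (monomial_mem_of_le le_rfl hgf _)
    calc k ∈ P ↔ k * h ∈ P := ⟨P.mul_mem_right _, fun hk => (hP.mem_or_mem hk).resolve_right hlead⟩
      _ ↔ k * h * f ∈ J := hf _
      _ ↔ k * (h * f') ∈ J := by
        rw [← J.sub_mem_iff_left hterm]
        simp only [f', mul_sub, mul_assoc]

theorem monomial_mem_of_eq_colon {J P : Ideal (MvPolynomial (Fin n) K)}
    (hJ : IsMonomialIdeal J) [hP : P.IsPrime] {f : MvPolynomial (Fin n) K}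
    (hf : ∀ g, g ∈ P ↔ g * f ∈ J) {g : MvPolynomial (Fin n) K} (hg : g ∈ P)
    {a : Fin n →₀ ℕ} (ha : a ∈ g.support) : monomial a (1 : K) ∈ P := by
  induction hN : g.support.card using Nat.strong_induction_on generalizing g with
  | _ N ih =>
    subst hN
    have hg0 : g ≠ 0 := by rintro rfl; simp at ha
    have hlead := monomial_degree_mem_of_eq_colon hJ hf hg hg0
    set b := MonomialOrder.lex.degree g
    have hb : b ∈ g.support := MonomialOrder.lex.degree_mem_support hg0
    by_cases hab : a = b
    · exact hab ▸ hlead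
    · refine ih _ ?_ (g := g - monomial b (g.coeff b))
        (P.sub_mem hg (monomial_mem_of_le le_rfl hlead _)) ?_ rfl
      · rw [support_sub_monomial_coeff]
        exact Finset.card_erase_lt_of_mem hb
      · rw [support_sub_monomial_coeff]
        exact Finset.mem_erase.2 ⟨hab, ha⟩

theorem mem_associatedPrimes_quotient_iff {R : Type*} [CommRing R] [IsNoetherianRing R]
    {J P : Ideal R} :
    P ∈ associatedPrimes R (R ⧸ J) ↔ P.IsPrime ∧ ∃ f, ∀ g, g ∈ P ↔ g * f ∈ J := by
  rw [AssociatedPrimes.mem_iff, isAssociatedPrime_iff, Ideal.Quotient.mk_surjective.exists]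
  simp only [SetLike.ext_iff, Submodule.mem_colon_singleton, Submodule.mem_bot]
  simp only [← Ideal.Quotient.mk_eq_mk, ← Submodule.Quotient.mk_smul, smul_eq_mul,
    Submodule.Quotient.mk_eq_zero]

/-- Associated primes of a monomial ideal are the monomial primes that are colons by monomials. -/
theorem IsMonomialIdeal.mem_associatedPrimes_iff {J P : Ideal (MvPolynomial (Fin n) K)}
    (hJ : IsMonomialIdeal J) :
    P ∈ associatedPrimes (MvPolynomial (Fin n) K) (MvPolynomial (Fin n) K ⧸ J) ↔ P.IsPrime ∧
      (∀ g ∈ P, ∀ a ∈ g.support, monomial a (1 : K) ∈ P) ∧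
      ∃ a, ∀ d, monomial d (1 : K) ∈ P ↔ monomial (d + a) (1 : K) ∈ J := by
  rw [mem_associatedPrimes_quotient_iff]
  refine and_congr_right fun hP => ⟨?_, ?_⟩
  · rintro ⟨f, hf⟩
    have hmono : ∀ g ∈ P, ∀ a ∈ g.support, monomial a (1 : K) ∈ P :=
      fun g hg a ha => monomial_mem_of_eq_colon hJ hf hg ha
    refine ⟨hmono, ?_⟩
    by_contra! hcon
    have hmem : ∀ d a, monomial d (1 : K) ∈ P → a ∈ f.support →
        monomial (d + a) (1 : K) ∈ J := fun d a hd ha =>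
      hJ.mem_iff.1 ((hf _).1 hd) _ (by simpa using ha)
    choose d hd using hcon
    have hd' : ∀ a ∈ f.support, monomial (d a) (1 : K) ∉ P ∧ monomial (d a + a) (1 : K) ∈ J := by
      intro a ha
      have := hmem (d a) a
      grind
    have hprod : ∏ a ∈ f.support, monomial (d a) (1 : K) ∈ P := by
      refine (hf _).2 ?_
      nth_rw 2 [f.as_sum]
      rw [Finset.mul_sum]
      refine J.sum_mem fun a ha => ?_
      rw [← Finset.prod_erase_mul _ _ ha, mul_assoc, monomial_mul]
      exact J.mul_mem_left _ (monomial_mem_of_le le_rfl (hd' a ha).2 _)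
    obtain ⟨a, ha, hda⟩ := hP.prod_mem_iff.1 hprod
    exact (hd' a ha).1 hda
  · rintro ⟨hmono, a, ha⟩
    refine ⟨monomial a 1, fun g => ?_⟩
    rw [mul_monomial_mem_iff hJ]
    simp only [← ha]
    exact ⟨hmono g, mem_of_forall_support⟩

theorem IsMonomialIdeal.associatedPrimes_sqPow {J : Ideal (MvPolynomial (Fin n) K)}
    (hJ : IsMonomialIdeal J) {m : ℕ} (hm : 0 < m) :
    associatedPrimes (MvPolynomial (Fin n) K) (MvPolynomial (Fin n) K ⧸ _root_.sqPow m J) =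
      associatedPrimes (MvPolynomial (Fin n) K) (MvPolynomial (Fin n) K ⧸ J) := by
  ext P
  rw [hJ.mem_associatedPrimes_iff, (hJ.sqPow m).mem_associatedPrimes_iff]
  refine and_congr_right fun hP => and_congr_right fun _ => ?_
  have hsmul : ∀ d : Fin n →₀ ℕ, monomial (m • d) (1 : K) ∈ P ↔ monomial d (1 : K) ∈ P := by
    intro d
    rw [← hP.pow_mem_iff_mem (r := monomial d 1) m hm, monomial_pow, one_pow]
  simp only [monomial_mem_sqPow_iff hJ hm]
  constructor
  · rintro ⟨c, hc⟩
    refine ⟨c.mapRange (· / m) (Nat.zero_div m), fun d => ?_⟩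
    have heq : (m • d + c).mapRange (· / m) (Nat.zero_div m) =
        d + c.mapRange (· / m) (Nat.zero_div m) := by
      ext i
      simp [Nat.mul_add_div hm]
    rw [← hsmul, hc, heq]
  · rintro ⟨a, ha⟩
    refine ⟨m • a + Finsupp.equivFunOnFinite.symm fun _ => m - 1, fun d => ?_⟩
    set e : Fin n →₀ ℕ := d.mapRange (fun x => (x + (m - 1)) / m)
      (by simp [Nat.div_eq_of_lt, hm]) with he
    have hde : monomial d (1 : K) ∈ P ↔ monomial e (1 : K) ∈ P := by
      refine ⟨fun h => (hsmul e).1 (monomial_mem_of_le (fun i => ?_) h 1),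
        fun h => monomial_mem_of_le (fun i => ?_) h 1⟩
      · have := Nat.lt_mul_div_succ (d i + (m - 1)) hm
        simp only [he, Finsupp.smul_apply, Finsupp.mapRange_apply, smul_eq_mul]
        rw [mul_add] at this
        omega
      · simp only [he, Finsupp.mapRange_apply]
        obtain h0 | h0 := Nat.eq_zero_or_pos (d i)
        · simp [h0, Nat.div_eq_of_lt, hm]
        · refine Nat.div_le_of_le_mul ?_
          obtain ⟨k, rfl⟩ := Nat.exists_eq_add_of_lt hm
          obtain ⟨l, hl⟩ := Nat.exists_eq_add_of_lt h0
          rw [hl]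
          ring_nf
          lia
    have heq : (d + (m • a + Finsupp.equivFunOnFinite.symm fun _ => m - 1)).mapRange (· / m)
        (Nat.zero_div m) = e + a := by
      ext i
      simp only [he, Finsupp.mapRange_apply, Finsupp.add_apply, Finsupp.smul_apply, smul_eq_mul,
        Finsupp.equivFunOnFinite_symm_apply_apply]
      rw [← Nat.add_mul_div_left _ _ hm]
      congr 1
      ring
    rw [hde, ha, heq]

end MonomialIdeals

/-- Let `I` be a monomial ideal. If `I` is normally torsion-free, then
`I^[m]` is normally torsion-free for all `m ≥ 2`. -/
theorem sqPow_normallyTorsionFree (n : ℕ) (K : Type*) [Field K]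
    (I : Ideal (MvPolynomial (Fin n) K)) (hI : IsMonomialIdeal I)
    (hntf : NormallyTorsionFree I) (m : ℕ) (hm : 2 ≤ m) :
    NormallyTorsionFree (sqPow m I) := by
  intro s hs
  have hm0 : 0 < m := by omega
  have hpow : sqPow m I ^ s = sqPow m (I ^ s) := (Ideal.map_pow _ I s).symm
  rw [hpow, (hI.pow s).associatedPrimes_sqPow hm0, hI.associatedPrimes_sqPow hm0]
  exact hntf s hs
end

section
/- Let I ⊆ R be a monomial ideal. Then for all integers m ≥ 2 and s ≥ 2, the s-th symbolic power of the m-th square power equals the m-th square power of the s-th symbolic power: (I^[m])^(s) = (I^(s))^[m]. -/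
/-- The `s`-th symbolic power of `I`: the intersection, over the minimal primes `p` of `I`,
of the contractions `I^s R_p ∩ R` of `I^s R_p` under the localization map `R → R_p`. -/
noncomputable def symbPow {R : Type*} [CommRing R] (I : Ideal R) (s : ℕ) : Ideal R :=
  ⨅ p : I.minimalPrimes,
    letI : p.1.IsPrime := p.2.1.1
    (Ideal.map (algebraMap R (Localization.AtPrime p.1)) (I ^ s)).comap
      (algebraMap R (Localization.AtPrime p.1))

namespace MvPolynomial

section Expand

variable {σ R : Type*} [CommRing R] (m : ℕ)

/-- The coordinate along `X^b` of a polynomial, for the decomposition of `R[X]` as a module over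
the image of `expand m` with basis the monomials having all exponents less than `m`. -/
noncomputable def expandCoord (b : σ →₀ ℕ) : MvPolynomial σ R →ₗ[R] MvPolynomial σ R :=
  open Classical in
  (basisMonomials σ R).constr R fun c =>
    if c.mapRange (· % m) (Nat.zero_mod m) = b then
      monomial (c.mapRange (· / m) (Nat.zero_div m)) 1 else 0

open Classical in
theorem expandCoord_monomial_one (b c : σ →₀ ℕ) :
    expandCoord m b (monomial c (1 : R)) =
      if c.mapRange (· % m) (Nat.zero_mod m) = b then
        monomial (c.mapRange (· / m) (Nat.zero_div m)) 1 else 0 := by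
  rw [expandCoord, ← (congrFun (coe_basisMonomials σ R) c :)]
  exact (basisMonomials σ R).constr_basis R _ c

variable {m}

theorem expandCoord_expand_mul (hm : 0 < m) (b : σ →₀ ℕ) (f g : MvPolynomial σ R) :
    expandCoord m b (expand m f * g) = f * expandCoord m b g := by
  have key : ((LinearMap.mul R (MvPolynomial σ R)).compl₁₂ (expand m).toLinearMap
        LinearMap.id).compr₂ (expandCoord m b) =
      (LinearMap.mul R (MvPolynomial σ R)).compl₁₂ LinearMap.id (expandCoord m b) := by
    refine (basisMonomials σ R).ext fun a => (basisMonomials σ R).ext fun c => ?_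
    have hmod : (m • a + c).mapRange (· % m) (Nat.zero_mod m) =
        c.mapRange (· % m) (Nat.zero_mod m) := by
      ext i; simp
    have hdiv : (m • a + c).mapRange (· / m) (Nat.zero_div m) =
        a + c.mapRange (· / m) (Nat.zero_div m) := by
      ext i; simp [Nat.mul_add_div hm]
    simp only [coe_basisMonomials, LinearMap.compr₂_apply, LinearMap.compl₁₂_apply,
      LinearMap.mul_apply', AlgHom.toLinearMap_apply, LinearMap.id_apply, expand_monomial,
      monomial_mul, mul_one, expandCoord_monomial_one, hdiv]
    split_ifs <;> simp_all [monomial_mul]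
  exact LinearMap.congr_fun₂ key f g

theorem sum_expand_expandCoord_mul_monomial [Finite σ] (hm : 0 < m) :
    ∃ s : Finset (σ →₀ ℕ), ∀ g : MvPolynomial σ R,
      g = ∑ b ∈ s, expand m (expandCoord m b g) * monomial b 1 := by
  classical
  refine ⟨Finset.Iic (Finsupp.equivFunOnFinite.symm fun _ => m), fun g => ?_⟩
  have key : LinearMap.id = ∑ b ∈ Finset.Iic (Finsupp.equivFunOnFinite.symm fun _ : σ => m),
      LinearMap.mulRight R (monomial b (1 : R)) ∘ₗ (expand m).toLinearMap ∘ₗ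
        expandCoord m b := by
    refine (basisMonomials σ R).ext fun c => ?_
    have hc : m • c.mapRange (· / m) (Nat.zero_div m) + c.mapRange (· % m) (Nat.zero_mod m)
        = c := by
      ext i; simp [Nat.div_add_mod]
    have hmem : c.mapRange (· % m) (Nat.zero_mod m) ≤
        Finsupp.equivFunOnFinite.symm fun _ => m := by
      intro i; simpa using (Nat.mod_lt _ hm).le
    simp only [coe_basisMonomials, LinearMap.id_apply, LinearMap.sum_apply, LinearMap.comp_apply,
      expandCoord_monomial_one, AlgHom.toLinearMap_apply, LinearMap.mulRight_apply]
    rw [Finset.sum_eq_single (c.mapRange (· % m) (Nat.zero_mod m))]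
    · simp [monomial_mul, hc]
    · intro b _ hb
      simp [hb.symm]
    · intro h
      exact absurd (Finset.mem_Iic.mpr hmem) h
  simpa using LinearMap.congr_fun key g

theorem mem_map_expand_iff [Finite σ] (hm : 0 < m) {I : Ideal (MvPolynomial σ R)}
    {g : MvPolynomial σ R} :
    g ∈ I.map (expand m) ↔ ∀ b, expandCoord m b g ∈ I := by
  constructor
  · intro hg b
    suffices h : ∀ a, expandCoord m b (a * g) ∈ I by simpa using h 1
    induction hg using Submodule.span_induction with
    | mem x hx =>
      intro a
      obtain ⟨f, hf, rfl⟩ := hx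
      rw [mul_comm, expandCoord_expand_mul hm]
      exact I.mul_mem_right _ hf
    | zero => simp
    | add x y _ _ hx hy =>
      intro a
      rw [mul_add, map_add]
      exact I.add_mem (hx a) (hy a)
    | smul c x _ hx =>
      intro a
      rw [smul_eq_mul, ← mul_assoc]
      exact hx (a * c)
  · intro h
    obtain ⟨s, hs⟩ := sum_expand_expandCoord_mul_monomial (σ := σ) (R := R) hm
    rw [hs g]
    exact sum_mem fun b _ => Ideal.mul_mem_right _ _ (Ideal.mem_map_of_mem _ (h b))

theorem expand_isIntegral (hm : 0 < m) :
    (expand m : MvPolynomial σ R →ₐ[R] MvPolynomial σ R).toRingHom.IsIntegral := by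
  intro f
  induction f using MvPolynomial.induction_on with
  | C r =>
    rw [← expand_C m r]
    exact RingHom.isIntegralElem_map _
  | add f g hf hg => exact RingHom.IsIntegralElem.add _ hf hg
  | mul_X f i hf =>
    refine RingHom.IsIntegralElem.mul _ hf ?_
    have h : (expand m : MvPolynomial σ R →ₐ[R] MvPolynomial σ R).toRingHom.IsIntegralElem
        (X i ^ m) := by
      rw [← expand_X]
      exact RingHom.isIntegralElem_map _
    obtain ⟨p, hp, h0⟩ := h
    exact ⟨Polynomial.expand _ m p, hp.expand hm, by
      rwa [Polynomial.expand_eq_comp_X_pow, Polynomial.eval₂_comp, Polynomial.eval₂_X_pow]⟩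

end Expand

end MvPolynomial

namespace Ideal

/-- If `q` is the only prime of `S` over the prime `p` of `R`, for an integral ring homomorphism
`φ : R → S`, then every `x ∉ q` divides `φ r` for some `r ∉ p`. -/
theorem exists_notMem_dvd_of_isIntegral {R S : Type*} [CommRing R] [CommRing S] {φ : R →+* S}
    (hφ : φ.IsIntegral) {p : Ideal R} [p.IsPrime] {q : Ideal S} [q.IsPrime]
    (hqp : q.comap φ = p) (hq : ∀ Q : Ideal S, Q.IsPrime → Q.comap φ = p → Q = q)
    {x : S} (hx : x ∉ q) : ∃ r ∉ p, x ∣ φ r := by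
  let := φ.toAlgebra
  have : Algebra.IsIntegral R S := ⟨hφ⟩
  refine exists_notMem_dvd_algebraMap_of_primesOver_eq_singleton (q := q) ?_ x hx
  ext Q
  exact ⟨fun h => hq Q h.1 h.2.over.symm, fun h => h ▸ ⟨inferInstance, ⟨hqp.symm⟩⟩⟩

theorem eq_of_le_of_comap_eq_of_isIntegral {R S : Type*} [CommRing R] [CommRing S] {φ : R →+* S}
    (hφ : φ.IsIntegral) {P Q : Ideal S} [P.IsPrime] (hPQ : P ≤ Q)
    (h : Q.comap φ = P.comap φ) : P = Q := by
  let := φ.toAlgebra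
  refine le_antisymm hPQ fun x hx => by_contra fun hxP => ?_
  exact (comap_lt_comap_of_integral_mem_sdiff (R := R) hPQ ⟨hx, hxP⟩ (hφ x)).ne h.symm

end Ideal

theorem mem_symbPow_iff {R : Type*} [CommRing R] {I : Ideal R} {s : ℕ} {f : R} :
    f ∈ symbPow I s ↔ ∀ p ∈ I.minimalPrimes, ∃ u ∉ p, u * f ∈ I ^ s := by
  rw [symbPow, Ideal.mem_iInf, Subtype.forall]
  refine forall₂_congr fun p hp => ?_
  have : p.IsPrime := hp.1.1
  exact IsLocalization.algebraMap_mem_map_algebraMap_iff p.primeCompl _ _ _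

namespace MvPolynomial

theorem sub_aeval_ite_mem {σ R : Type*} [CommRing R] {F : Set σ} [DecidablePred (· ∈ F)]
    {J : Ideal (MvPolynomial σ R)} (hJ : ∀ i ∈ F, X i ∈ J) (f : MvPolynomial σ R) :
    f - aeval (fun i => if i ∈ F then 0 else X i) f ∈ J := by
  have key : Ideal.Quotient.mkₐ R J =
      (Ideal.Quotient.mkₐ R J).comp (aeval fun i => if i ∈ F then 0 else X i) := by
    refine algHom_ext fun i => ?_
    by_cases hi : i ∈ F
    · simpa [hi] using Ideal.Quotient.eq_zero_iff_mem.mpr (hJ i hi)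
    · simp [hi]
  exact Ideal.Quotient.eq.mp (DFunLike.congr_fun key f)

end MvPolynomial

section Monomial

open MvPolynomial

variable {n : ℕ} {K : Type*} [Field K] {I p : Ideal (MvPolynomial (Fin n) K)} {m : ℕ}

open Classical in
/-- A minimal prime of a monomial ideal is the kernel of the map killing a set of variables. -/
theorem IsMonomialIdeal.exists_minimalPrime_eq_ker (hI : IsMonomialIdeal I)
    (hp : p ∈ I.minimalPrimes) :
    ∃ F : Set (Fin n), (∀ i ∈ F, X i ∈ p) ∧ p = RingHom.ker (aeval (R := K) fun i : Fin n =>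
      if i ∈ F then (0 : MvPolynomial (Fin n) K) else X i) := by
  have := hp.1.1
  obtain ⟨F, hF⟩ : ∃ F : Set (Fin n), ∀ i, i ∈ F ↔ X i ∈ p := ⟨{i | X i ∈ p}, fun _ => Iff.rfl⟩
  refine ⟨F, fun i => (hF i).mp, ?_⟩
  set ψ := aeval (R := K) fun i : Fin n =>
      if i ∈ F then (0 : MvPolynomial (Fin n) K) else X i with hψ
  have hle : RingHom.ker ψ ≤ p := fun f hf => by
    have := sub_aeval_ite_mem (fun i => (hF i).mp) f
    rwa [← hψ, (hf : ψ f = 0), sub_zero] at this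
  refine le_antisymm (hp.2 ⟨RingHom.ker_isPrime _, ?_⟩ hle) hle
  obtain ⟨A, rfl⟩ := hI
  rw [Ideal.span_le]
  rintro _ ⟨a, ha, rfl⟩
  have hap : monomial a (1 : K) ∈ p := hp.1.2 (Ideal.subset_span ⟨a, ha, rfl⟩)
  rw [monomial_eq, C_1, one_mul, Finsupp.prod, Ideal.IsPrime.prod_mem_iff] at hap
  obtain ⟨i, hi, hip⟩ := hap
  have hip' : X i ∈ p := Ideal.IsPrime.mem_of_pow_mem ‹_› _ hip
  change ψ (monomial a 1) = 0
  rw [aeval_monomial, Finsupp.prod, Finset.prod_eq_zero hi, mul_zero]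
  simpa [(hF i).mpr hip'] using Finsupp.mem_support_iff.mp hi

theorem IsMonomialIdeal.minimalPrime_comap_expand (hI : IsMonomialIdeal I)
    (hp : p ∈ I.minimalPrimes) (hm : 0 < m) : p.comap (expand m) = p := by
  classical
  obtain ⟨F, -, rfl⟩ := hI.exists_minimalPrime_eq_ker hp
  have key : (aeval fun i : Fin n => if i ∈ F then (0 : MvPolynomial (Fin n) K) else X i).comp
      (expand m) = (expand m).comp
        (aeval fun i => if i ∈ F then (0 : MvPolynomial (Fin n) K) else X i) := by
    refine algHom_ext fun i => ?_
    by_cases hi : i ∈ F <;> simp [hi, hm.ne']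
  ext f
  have hf := DFunLike.congr_fun key f
  rw [AlgHom.comp_apply, AlgHom.comp_apply] at hf
  rw [Ideal.mem_comap, RingHom.mem_ker, RingHom.mem_ker, hf, expand_eq_zero hm]

theorem IsMonomialIdeal.minimalPrime_le (hI : IsMonomialIdeal I)
    (hp : p ∈ I.minimalPrimes) {J : Ideal (MvPolynomial (Fin n) K)}
    (hJ : ∀ i, X i ∈ p → X i ∈ J) : p ≤ J := by
  classical
  obtain ⟨F, hF, hker⟩ := hI.exists_minimalPrime_eq_ker hp
  intro f hf
  have := sub_aeval_ite_mem (fun i hi => hJ i (hF i hi)) f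
  rw [hker, RingHom.mem_ker] at hf
  rwa [hf, sub_zero] at this

theorem IsMonomialIdeal.eq_minimalPrime_of_comap_expand_eq (hI : IsMonomialIdeal I)
    (hp : p ∈ I.minimalPrimes) (hm : 0 < m) {Q : Ideal (MvPolynomial (Fin n) K)} (hQ : Q.IsPrime)
    (h : Q.comap (expand m) = p) : Q = p := by
  have := hp.1.1
  refine (Ideal.eq_of_le_of_comap_eq_of_isIntegral (expand_isIntegral hm)
    (hI.minimalPrime_le hp fun i hi => ?_)
    (h.trans (hI.minimalPrime_comap_expand hp hm).symm)).symm
  rw [← h, Ideal.mem_comap, expand_X] at hi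
  exact hQ.mem_of_pow_mem _ hi

theorem IsMonomialIdeal.minimalPrimes_map_expand (hI : IsMonomialIdeal I) (hm : 0 < m) :
    (I.map (expand m)).minimalPrimes = I.minimalPrimes := by
  rw [← Ideal.radical_minimalPrimes, ← Ideal.radical_minimalPrimes (I := I)]
  congr 1
  obtain ⟨A, rfl⟩ := hI
  have hpow (a : Fin n →₀ ℕ) :
      expand m (monomial a (1 : K)) = monomial a 1 ^ m := by
    rw [expand_monomial, monomial_pow, one_pow]
  refine le_antisymm (Ideal.radical_mono ?_) (Ideal.radical_le_radical_iff.mpr ?_)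
  · rw [Ideal.map_span, Ideal.span_le]
    rintro _ ⟨_, ⟨a, ha, rfl⟩, rfl⟩
    rw [SetLike.mem_coe, hpow]
    exact Ideal.pow_mem_of_mem _ (Ideal.subset_span (Set.mem_image_of_mem _ ha)) m hm
  · rw [Ideal.span_le]
    rintro _ ⟨a, ha, rfl⟩
    exact ⟨m, hpow a ▸ Ideal.mem_map_of_mem _ (Ideal.subset_span (Set.mem_image_of_mem _ ha))⟩

end Monomial

/-- Let `I` be a monomial ideal. Then for all `m ≥ 2` and `s ≥ 2`,
`(I^[m])^(s) = (I^(s))^[m]`. -/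
theorem sqPow_symbPow_comm (n : ℕ) (K : Type*) [Field K]
    (I : Ideal (MvPolynomial (Fin n) K)) (hI : IsMonomialIdeal I)
    (m : ℕ) (hm : 2 ≤ m) (s : ℕ) (hs : 2 ≤ s) :
    symbPow (sqPow m I) s = sqPow m (symbPow I s) := by
  have hm0 : 0 < m := by omega
  change symbPow (I.map (MvPolynomial.expand m)) s = (symbPow I s).map (MvPolynomial.expand m)
  apply le_antisymm
  · intro g hg
    rw [mem_symbPow_iff, hI.minimalPrimes_map_expand hm0, ← Ideal.map_pow] at hg
    refine (MvPolynomial.mem_map_expand_iff hm0).mpr fun b => mem_symbPow_iff.mpr fun p hp => ?_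
    obtain ⟨v, hv, hvg⟩ := hg p hp
    have := hp.1.1
    obtain ⟨u, hu, w, hw⟩ := Ideal.exists_notMem_dvd_of_isIntegral
      (MvPolynomial.expand_isIntegral hm0) (hI.minimalPrime_comap_expand hp hm0)
      (fun Q hQ h => hI.eq_minimalPrime_of_comap_expand_eq hp hm0 hQ h) hv
    refine ⟨u, hu, ?_⟩
    rw [← MvPolynomial.expandCoord_expand_mul hm0]
    refine (MvPolynomial.mem_map_expand_iff hm0).mp ?_ b
    have : MvPolynomial.expand m u * g = w * (v * g) := by
      rw [show MvPolynomial.expand m u = v * w from hw]; ring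
    exact this ▸ Ideal.mul_mem_left _ w hvg
  · rw [Ideal.map_le_iff_le_comap]
    intro f hf
    rw [mem_symbPow_iff] at hf
    rw [Ideal.mem_comap, mem_symbPow_iff, hI.minimalPrimes_map_expand hm0, ← Ideal.map_pow]
    intro p hp
    obtain ⟨u, hu, huf⟩ := hf p hp
    refine ⟨MvPolynomial.expand m u, fun h => hu ?_, ?_⟩
    · rwa [← Ideal.mem_comap, hI.minimalPrime_comap_expand hp hm0] at h
    · rw [← map_mul]
      exact Ideal.mem_map_of_mem _ huf
end
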